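/- Let p > 2 and let A ∈ ℝ^{m×n} satisfy: for every k-sparse x ∈ ℝⁿ, ‖x‖_p ≤ ‖Ax‖_p ≤ D·‖x‖_p (i.e., A is (k,D)-ℓ_p-RIP with normalization K = 1), where 1 ≤ k ≤ n. Then for every subset S ⊆ {1,…,n} with |S| ≤ k, it holds that Σ_{i=1}^m ‖A_{i,S}‖₂^p ≤ |S|·D^p, where A_{i,S} denotes the i-th row of A restricted to the coordinates in S. -/

import Mathlib

open Finset

/-- The ℓ_p norm of a vector `x`, `‖x‖_p = (∑ i, |x i|^p)^(1/p)`. -/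
noncomputable def pNorm (p : ℝ) {ι : Type*} [Fintype ι] (x : ι → ℝ) : ℝ :=
  (∑ i, |x i| ^ p) ^ (1 / p)

/-- The (ℓ_q, ℓ_p)-distortion of a vector `x ∈ ℝⁿ`:
`Δ_{q,p}(x) = ‖x‖_p · n^(1/q - 1/p) / ‖x‖_q`. -/
noncomputable def distortion (q p : ℝ) {ι : Type*} [Fintype ι] (x : ι → ℝ) : ℝ :=
  pNorm p x * (Fintype.card ι : ℝ) ^ (1 / q - 1 / p) / pNorm q x

/-- A vector is `k`-sparse if it has at most `k` nonzero entries. -/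
def IsSparse (k : ℝ) {ι : Type*} [Fintype ι] (x : ι → ℝ) : Prop :=
  ((Finset.univ.filter (fun i => x i ≠ 0)).card : ℝ) ≤ k

/-- A matrix `A` is `(k, D)`-ℓ_p-RIP if there is `K > 0` with
`K‖x‖_p ≤ ‖Ax‖_p ≤ D·K‖x‖_p` for every `k`-sparse `x`. -/
def IsRIP (p : ℝ) {ι κ : Type*} [Fintype ι] [Fintype κ] (A : Matrix ι κ ℝ) (k D : ℝ) : Prop :=
  ∃ K > 0, ∀ x : κ → ℝ, IsSparse k x →
    K * pNorm p x ≤ pNorm p (A.mulVec x) ∧ pNorm p (A.mulVec x) ≤ D * K * pNorm p x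

/-- A matrix `A ∈ ℝ^{m×n}` is `(k, D)`-ℓ₂-ARIP if there is `K > 0` with
`K‖x‖₂ ≤ ‖Ax‖₂ ≤ D·K‖x‖₂` for every `x` with `Δ_{1,2}(x) ≥ (n/k)^(1/2)`. -/
def IsARIP {ι κ : Type*} [Fintype ι] [Fintype κ] (A : Matrix ι κ ℝ) (k D : ℝ) : Prop :=
  ∃ K > 0, ∀ x : κ → ℝ, ((Fintype.card κ : ℝ) / k) ^ ((1 : ℝ) / 2) ≤ distortion 1 2 x →
    K * pNorm 2 x ≤ pNorm 2 (A.mulVec x) ∧ pNorm 2 (A.mulVec x) ≤ D * K * pNorm 2 x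

/-- The Frobenius norm of a matrix. -/
noncomputable def frobNorm {ι κ : Type*} [Fintype ι] [Fintype κ] (A : Matrix ι κ ℝ) : ℝ :=
  Real.sqrt (∑ i, ∑ j, (A i j) ^ 2)

lemma pNorm_nonneg (p : ℝ) {ι : Type*} [Fintype ι] (x : ι → ℝ) : 0 ≤ pNorm p x :=
  Real.rpow_nonneg (Finset.sum_nonneg fun _ _ => Real.rpow_nonneg (abs_nonneg _) _) _

lemma pNorm_rpow {p : ℝ} (hp : p ≠ 0) {ι : Type*} [Fintype ι] (x : ι → ℝ) :
    pNorm p x ^ p = ∑ i, |x i| ^ p := by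
  rw [pNorm, ← Real.rpow_mul (Finset.sum_nonneg fun _ _ => Real.rpow_nonneg (abs_nonneg _) _),
    one_div_mul_cancel hp, Real.rpow_one]

lemma pNorm_two_rpow (p : ℝ) {ι : Type*} [Fintype ι] (x : ι → ℝ) :
    pNorm 2 x ^ p = (∑ i, x i ^ 2) ^ (p / 2) := by
  rw [pNorm, ← Real.rpow_mul (Finset.sum_nonneg fun _ _ => Real.rpow_nonneg (abs_nonneg _) _),
    one_div_mul_eq_div]
  simp only [Real.rpow_two, sq_abs]

/-- The vector with entries `1` on `T`, `-1` on `S \ T` and `0` outside `S`. -/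
def signVec {ι : Type*} [DecidableEq ι] (S T : Finset ι) (j : ι) : ℝ :=
  if j ∈ S then if j ∈ T then 1 else -1 else 0

lemma abs_signVec {ι : Type*} [DecidableEq ι] (S T : Finset ι) (j : ι) :
    |signVec S T j| = if j ∈ S then 1 else 0 := by
  unfold signVec
  split_ifs <;> simp

lemma sum_powerset_sq_add_sum_sign {ι : Type*} [DecidableEq ι] (a : ι → ℝ) (S : Finset ι) (c : ℝ) :
    ∑ T ∈ S.powerset, (c + ∑ j ∈ S, if j ∈ T then a j else -a j) ^ 2 =
      2 ^ S.card * (c ^ 2 + ∑ j ∈ S, a j ^ 2) := by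
  induction S using Finset.induction_on generalizing c with
  | empty => simp
  | insert s S hs ih =>
    have h₁ : ∀ T ∈ S.powerset, (c + ∑ j ∈ insert s S, if j ∈ T then a j else -a j) ^ 2 =
        ((c - a s) + ∑ j ∈ S, if j ∈ T then a j else -a j) ^ 2 := by
      intro T hT
      have hsT : s ∉ T := fun h => hs (Finset.mem_powerset.1 hT h)
      rw [Finset.sum_insert hs, if_neg hsT]
      ring
    have h₂ : ∀ T ∈ S.powerset,
        (c + ∑ j ∈ insert s S, if j ∈ insert s T then a j else -a j) ^ 2 =
        ((c + a s) + ∑ j ∈ S, if j ∈ T then a j else -a j) ^ 2 := by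
      intro T _
      rw [Finset.sum_insert hs, if_pos (Finset.mem_insert_self s T), add_assoc]
      congr 3
      refine Finset.sum_congr rfl fun j hj => ?_
      have hjs : j ≠ s := fun h => hs (h ▸ hj)
      simp [Finset.mem_insert, hjs]
    rw [Finset.sum_powerset_insert hs, Finset.sum_congr rfl h₁, Finset.sum_congr rfl h₂, ih, ih,
      Finset.card_insert_of_notMem hs, Finset.sum_insert hs]
    ring

lemma sum_powerset_sq_sum_mul_signVec {ι : Type*} [Fintype ι] [DecidableEq ι] (a : ι → ℝ)
    (S : Finset ι) :
    ∑ T ∈ S.powerset, (∑ j, a j * signVec S T j) ^ 2 = 2 ^ S.card * ∑ j ∈ S, a j ^ 2 := by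
  have h := sum_powerset_sq_add_sum_sign a S 0
  simp only [zero_add, ne_eq, OfNat.ofNat_ne_zero, not_false_eq_true, zero_pow] at h
  rw [← h]
  refine Finset.sum_congr rfl fun T _ => ?_
  simp [signVec, Finset.sum_ite_mem]

/-- The easy direction of Khintchine's inequality for exponents `p ≥ 2`. -/
lemma rpow_sum_sq_le_sum_powerset {ι : Type*} [Fintype ι] [DecidableEq ι] {p : ℝ} (hp : 2 ≤ p)
    (a : ι → ℝ) (S : Finset ι) :
    2 ^ S.card * (∑ j ∈ S, a j ^ 2) ^ (p / 2) ≤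
      ∑ T ∈ S.powerset, |∑ j, a j * signVec S T j| ^ p := by
  have hN : (0 : ℝ) < 2 ^ S.card := by positivity
  have h := Real.rpow_arith_mean_le_arith_mean_rpow S.powerset
    (fun _ => ((2 : ℝ) ^ S.card)⁻¹) (fun T => (∑ j, a j * signVec S T j) ^ 2)
    (fun _ _ => by positivity) (by simp [Finset.card_powerset]) (fun _ _ => sq_nonneg _)
    (p := p / 2) (by linarith)
  rw [← Finset.mul_sum, ← Finset.mul_sum, sum_powerset_sq_sum_mul_signVec,
    inv_mul_cancel_left₀ hN.ne', inv_mul_eq_div, le_div_iff₀' hN] at h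
  refine h.trans_eq (Finset.sum_congr rfl fun T _ => ?_)
  rw [← sq_abs, ← Real.rpow_natCast_mul (abs_nonneg _)]
  congr 1
  push_cast
  ring

/-- Let `p > 2` and suppose `A ∈ ℝ^{m×n}` satisfies `‖x‖_p ≤ ‖Ax‖_p ≤ D‖x‖_p` for every
`k`-sparse `x`, where `1 ≤ k ≤ n`. Then for every `S ⊆ {1,…,n}` with `|S| ≤ k`,
`∑ᵢ ‖A_{i,S}‖₂^p ≤ |S|·D^p`. -/
theorem rip_restricted_rows_upper {m n : ℕ} (p D : ℝ) (hp : 2 < p)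
    (k : ℕ) (hk : 1 ≤ k) (hkn : k ≤ n) (A : Matrix (Fin m) (Fin n) ℝ)
    (hA : ∀ x : Fin n → ℝ, (Finset.univ.filter (fun j => x j ≠ 0)).card ≤ k →
      pNorm p x ≤ pNorm p (A.mulVec x) ∧ pNorm p (A.mulVec x) ≤ D * pNorm p x)
    (S : Finset (Fin n)) (hS : S.card ≤ k) :
    ∑ i : Fin m, pNorm 2 (fun j : {j : Fin n // j ∈ S} => A i j) ^ p ≤ (S.card : ℝ) * D ^ p := by
  have hp0 : p ≠ 0 := by linarith
  have hD : 0 ≤ D := by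
    let e : Fin n → ℝ := Pi.single ⟨0, by omega⟩ 1
    have hpos : 0 < pNorm p e := by
      refine Real.rpow_pos_of_pos (Finset.sum_pos'
        (fun _ _ => Real.rpow_nonneg (abs_nonneg _) _) ⟨⟨0, by omega⟩, Finset.mem_univ _, ?_⟩) _
      simp [e]
    have he : (Finset.univ.filter (fun j => e j ≠ 0)).card ≤ k := by
      refine le_trans (Finset.card_le_one.2 fun i hi j hj => ?_) hk
      simp only [Finset.mem_filter, Finset.mem_univ, true_and, e, Pi.single_apply, ne_eq,
        ite_eq_right_iff, one_ne_zero, imp_false, not_not] at hi hj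
      rw [hi, hj]
    obtain ⟨h₁, h₂⟩ := hA e he
    by_contra! h
    nlinarith
  have hbound : ∀ T ∈ S.powerset,
      ∑ i, |∑ j, A i j * signVec S T j| ^ p ≤ S.card * D ^ p := by
    intro T _
    have hsparse : (Finset.univ.filter (fun j => signVec S T j ≠ 0)).card ≤ k := by
      refine (Finset.card_le_card fun j hj => ?_).trans hS
      by_contra hjS
      simp [signVec, hjS] at hj
    have hx : pNorm p (signVec S T) ^ p = S.card := by
      simp [pNorm_rpow hp0, abs_signVec, apply_ite (· ^ p), Real.zero_rpow hp0]
    calc ∑ i, |∑ j, A i j * signVec S T j| ^ p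
        = pNorm p (A.mulVec (signVec S T)) ^ p := (pNorm_rpow hp0 _).symm
      _ ≤ (D * pNorm p (signVec S T)) ^ p :=
        Real.rpow_le_rpow (pNorm_nonneg _ _) (hA _ hsparse).2 (by linarith)
      _ = S.card * D ^ p := by
        rw [Real.mul_rpow hD (pNorm_nonneg _ _), hx, mul_comm]
  refine le_of_mul_le_mul_left ?_ (show (0 : ℝ) < 2 ^ S.card by positivity)
  calc (2 : ℝ) ^ S.card * ∑ i, pNorm 2 (fun j : {j : Fin n // j ∈ S} => A i j) ^ p
      = ∑ i, 2 ^ S.card * (∑ j ∈ S, A i j ^ 2) ^ (p / 2) := by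
        rw [Finset.mul_sum]
        refine Finset.sum_congr rfl fun i _ => ?_
        rw [pNorm_two_rpow, Finset.sum_coe_sort S fun j => A i j ^ 2]
    _ ≤ ∑ i, ∑ T ∈ S.powerset, |∑ j, A i j * signVec S T j| ^ p :=
        Finset.sum_le_sum fun i _ => rpow_sum_sq_le_sum_powerset hp.le (A i) S
    _ = ∑ T ∈ S.powerset, ∑ i, |∑ j, A i j * signVec S T j| ^ p := Finset.sum_comm
    _ ≤ ∑ T ∈ S.powerset, S.card * D ^ p := Finset.sum_le_sum hbound
    _ = 2 ^ S.card * (S.card * D ^ p) := by simp [Finset.card_powerset]
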